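/- Let X₁, X₂ be CAT(0) spaces, A a complete metric space, and i_j : A → A_j ⊂ X_j isometries onto convex subsets A_j. Then the gluing X₁ ⊔_A X₂, with distance d(x,y) = inf_{a∈A} { d_j(x, i_j(a)) + d_{j'}(y, i_{j'}(a)) } for x ∈ X_j, y ∈ X_{j'}, j ≠ j', and the original distances within each X_j, is a CAT(0) space. -/

import Mathlib

/-- `γ` restricted to `[a,b]` is a unit-speed (arc-length parameterized) geodesic segment. -/
def IsGeodesicOn {X : Type*} [MetricSpace X] (γ : ℝ → X) (a b : ℝ) : Prop :=
  ∀ s ∈ Set.Icc a b, ∀ t ∈ Set.Icc a b, dist (γ s) (γ t) = |s - t|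

/-- A CAT(0) (NPC) space: a geodesic metric space satisfying the triangle comparison
inequality `d(z,x_λ)² ≤ (1-λ)d(z,x₀)² + λ d(z,x₁)² - λ(1-λ)d(x₀,x₁)²`. -/
def CAT0 (X : Type*) [MetricSpace X] : Prop :=
  (∀ x y : X, ∃ γ : ℝ → X, IsGeodesicOn γ 0 (dist x y) ∧ γ 0 = x ∧ γ (dist x y) = y) ∧
  (∀ x y z : X, ∀ γ : ℝ → X, IsGeodesicOn γ 0 (dist x y) → γ 0 = x → γ (dist x y) = y →
    ∀ l ∈ Set.Icc (0:ℝ) 1,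
      dist z (γ (l * dist x y)) ^ 2 ≤
        (1 - l) * dist z x ^ 2 + l * dist z y ^ 2 - l * (1 - l) * dist x y ^ 2)

/-- A subset is (geodesically) convex if every geodesic between two of its points lies in it. -/
def GeodConvex {X : Type*} [MetricSpace X] (F : Set X) : Prop :=
  ∀ x ∈ F, ∀ y ∈ F, ∀ γ : ℝ → X, IsGeodesicOn γ 0 (dist x y) → γ 0 = x → γ (dist x y) = y →
    ∀ t ∈ Set.Icc 0 (dist x y), γ t ∈ F


/-- Comparison inequality for `z` against the point `p` at parameter `l` between `x` and `y`. -/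
def Cmp {Z : Type*} [MetricSpace Z] (z x y p : Z) (l : ℝ) : Prop :=
  dist z p ^ 2 ≤ (1 - l) * dist z x ^ 2 + l * dist z y ^ 2 - l * (1 - l) * dist x y ^ 2

section aux
variable {Z : Type*} [MetricSpace Z]

lemma Cmp.swap {z x y p : Z} {l : ℝ} (h : Cmp z x y p l) : Cmp z y x p (1 - l) := by
  unfold Cmp at *
  rw [dist_comm y x]
  linarith

lemma Cmp.left_le {x y p : Z} {l : ℝ} (hl : 0 ≤ l) (h : Cmp x x y p l) :
    dist x p ≤ l * dist x y := by
  unfold Cmp at h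
  rw [dist_self] at h
  apply le_of_sq_le_sq _ (by positivity)
  nlinarith

lemma Cmp.right_le {x y p : Z} {l : ℝ} (hl : l ≤ 1) (h : Cmp y x y p l) :
    dist y p ≤ (1 - l) * dist x y := by
  have := Cmp.left_le (by linarith) h.swap
  rwa [dist_comm y x] at this

lemma Cmp.bound {x y p q : Z} {l m : ℝ} (hm : 0 ≤ m) (hm1 : m ≤ 1)
    (h1 : dist x p ≤ l * dist x y) (h2 : dist y p ≤ (1 - l) * dist x y)
    (h : Cmp p x y q m) : dist p q ≤ |l - m| * dist x y := by
  unfold Cmp at h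
  apply le_of_sq_le_sq _ (by positivity)
  rw [mul_pow, sq_abs]
  rw [dist_comm x p] at h1
  rw [dist_comm y p] at h2
  have e1 : dist p x ^ 2 ≤ (l * dist x y) ^ 2 := pow_le_pow_left₀ dist_nonneg h1 2
  have e2 : dist p y ^ 2 ≤ ((1 - l) * dist x y) ^ 2 := pow_le_pow_left₀ dist_nonneg h2 2
  nlinarith [mul_le_mul_of_nonneg_left e1 (sub_nonneg.2 hm1), mul_le_mul_of_nonneg_left e2 hm]

lemma Cmp.uniq {x y p q : Z} {l : ℝ} (hm : 0 ≤ l) (hm1 : l ≤ 1)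
    (h1 : dist x p ≤ l * dist x y) (h2 : dist y p ≤ (1 - l) * dist x y)
    (h : Cmp p x y q l) : p = q := by
  have := Cmp.bound hm hm1 h1 h2 h
  rw [sub_self, abs_zero, zero_mul] at this
  exact dist_le_zero.1 this

lemma titu (A B w w' : ℝ) (hw : 0 < w) (hw' : 0 < w') (h : w + w' = 1) :
    (A + B) ^ 2 ≤ A ^ 2 / w + B ^ 2 / w' := by
  obtain rfl : w' = 1 - w := by linarith
  have : A ^ 2 / w + B ^ 2 / (1 - w) - (A + B) ^ 2 = ((1 - w) * A - w * B) ^ 2 / (w * (1 - w)) := by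
    field_simp
    ring
  have h2 : 0 ≤ ((1 - w) * A - w * B) ^ 2 / (w * (1 - w)) := by positivity
  linarith

/-- Alexandrov's lemma, in inequality form. -/
lemma alex {z a x y p : Z} {l : ℝ} (hl : 0 ≤ l) (hl1 : l ≤ 1)
    (hd : dist z x = dist z a + dist a x)
    (h1 : Cmp a y x p l) (h2 : Cmp y y x p l)
    (hq : ∀ t : ℝ, 0 ≤ t → t ≤ 1 → ∃ q, Cmp z y a q t ∧ Cmp p y a q t) :
    Cmp z y x p l := by
  rcases eq_or_lt_of_le (dist_nonneg (x := z) (y := a)) with hu | hu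
  · obtain rfl := dist_eq_zero.1 hu.symm
    exact h1
  rcases eq_or_lt_of_le (dist_nonneg (x := a) (y := x)) with hv | hv
  · obtain rfl := dist_eq_zero.1 hv.symm
    obtain ⟨q, hq1, hq2⟩ := hq l hl hl1
    obtain rfl := Cmp.uniq hl hl1 (h2.left_le hl) (h1.right_le hl1) hq2
    exact hq1
  rcases eq_or_lt_of_le hl with rfl | hl0
  · have := h2.left_le le_rfl
    rw [zero_mul] at this
    obtain rfl := dist_le_zero.1 this
    unfold Cmp
    simp
  have hyp := pow_le_pow_left₀ dist_nonneg (h2.left_le hl) 2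
  rw [dist_comm y p] at hyp
  unfold Cmp at h1 ⊢
  rw [dist_comm a p] at h1
  rw [hd]
  set u := dist z a
  set v := dist a x
  have hM : 0 < u + l * v := by positivity
  have ht1 : 1 - l * (u + v) / (u + l * v) = u * (1 - l) / (u + l * v) := by
    field_simp
    ring
  have h1l : 0 ≤ 1 - l := by linarith
  have ht0 : 0 ≤ l * (u + v) / (u + l * v) := by positivity
  have ht1' : 0 ≤ 1 - l * (u + v) / (u + l * v) := by rw [ht1]; positivity
  obtain ⟨q, hq1, hq2⟩ := hq (l * (u + v) / (u + l * v)) ht0 (by linarith)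
  unfold Cmp at hq1 hq2
  rw [dist_comm a y] at h1
  set t := l * (u + v) / (u + l * v) with ht
  have hA : dist z q ^ 2 ≤ (1 - t) * dist z y ^ 2 + t * u ^ 2 - t * (1 - t) * dist y a ^ 2 := hq1
  have hB : dist p q ^ 2 ≤ (1 - t) * (l * dist y x) ^ 2
      + t * ((1 - l) * dist y a ^ 2 + l * v ^ 2 - l * (1 - l) * dist y x ^ 2)
      - t * (1 - t) * dist y a ^ 2 := by
    have := mul_le_mul_of_nonneg_left hyp ht1'
    have := mul_le_mul_of_nonneg_left h1 ht0
    linarith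
  have htri : dist z p ≤ dist z q + dist p q := by
    rw [dist_comm p q]; exact dist_triangle _ _ _
  have hsq := pow_le_pow_left₀ dist_nonneg htri 2
  have hw : 0 < u / (u + l * v) := by positivity
  have hw' : 0 < l * v / (u + l * v) := by positivity
  have hti := titu (dist z q) (dist p q) (u / (u + l * v)) (l * v / (u + l * v))
    hw hw' (by field_simp)
  have hA' := div_le_div_of_nonneg_right hA hw.le
  have hB' := div_le_div_of_nonneg_right hB hw'.le
  refine (hsq.trans hti).trans ((add_le_add hA' hB').trans (le_of_eq ?_))
  rw [ht1, ht]
  field_simp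
  ring

lemma kink {x y z a : Z} {w : ℝ} (hw : 0 ≤ w) (hw1 : w ≤ 1)
    (hu : dist x a = w * dist x y) (hv : dist y a = (1 - w) * dist x y)
    (hq : ∀ s : ℝ, 0 ≤ s → s ≤ 1 → ∃ q, Cmp x a z q s ∧ Cmp y a z q s) :
    Cmp z x y a w := by
  rcases eq_or_lt_of_le hw with rfl | hw0
  · rw [zero_mul] at hu
    obtain rfl := dist_eq_zero.1 hu
    unfold Cmp
    simp
  rcases eq_or_lt_of_le hw1 with rfl | hw10
  · rw [sub_self, zero_mul] at hv
    obtain rfl := dist_eq_zero.1 hv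
    unfold Cmp
    simp
  have hw' : 0 < 1 - w := by linarith
  set D := dist x y with hD
  set H := dist z a ^ 2 / (w * (1 - w)) with hH
  have hH0 : 0 ≤ H := by positivity
  have key : H ≤ dist z x ^ 2 / w + dist z y ^ 2 / (1 - w) - D ^ 2 := by
    apply le_of_forall_pos_le_add
    intro ε hε
    set s := ε / (H + ε) with hs
    have hs0 : 0 < s := by positivity
    have hs1 : s ≤ 1 := by rw [hs, div_le_one (by positivity)]; linarith
    have hsH : s * H ≤ ε := by
      have : s * (H + ε) = ε := by rw [hs]; field_simp
      nlinarith
    obtain ⟨q, h1, h2⟩ := hq s hs0.le hs1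
    unfold Cmp at h1 h2
    rw [hu, dist_comm x z, dist_comm a z] at h1
    rw [hv, dist_comm y z, dist_comm a z] at h2
    have htri : D ≤ dist x q + dist y q := by
      rw [dist_comm y q]; exact dist_triangle _ _ _
    have hsq := pow_le_pow_left₀ dist_nonneg htri 2
    have hti := titu (dist x q) (dist y q) w (1 - w) hw0 hw' (by ring)
    have h1' := div_le_div_of_nonneg_right h1 hw
    have h2' := div_le_div_of_nonneg_right h2 hw'.le
    have hfin := (hsq.trans hti).trans (add_le_add h1' h2')
    have e : ((1 - s) * (w * D) ^ 2 + s * dist z x ^ 2 - s * (1 - s) * dist z a ^ 2) / w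
      + ((1 - s) * ((1 - w) * D) ^ 2 + s * dist z y ^ 2 - s * (1 - s) * dist z a ^ 2) / (1 - w)
      = D ^ 2 + s * (dist z x ^ 2 / w + dist z y ^ 2 / (1 - w) - D ^ 2 - (1 - s) * H) := by
      rw [hH]
      field_simp
      ring
    rw [e] at hfin
    have h0 : 0 ≤ s * (dist z x ^ 2 / w + dist z y ^ 2 / (1 - w) - D ^ 2 - (1 - s) * H) := by
      linarith
    have := nonneg_of_mul_nonneg_right h0 hs0
    linarith
  have hm := mul_le_mul_of_nonneg_left key (mul_pos hw0 hw').le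
  have e1 : w * (1 - w) * H = dist z a ^ 2 := by rw [hH]; field_simp
  have e2 : w * (1 - w) * (dist z x ^ 2 / w + dist z y ^ 2 / (1 - w) - D ^ 2)
    = (1 - w) * dist z x ^ 2 + w * dist z y ^ 2 - w * (1 - w) * D ^ 2 := by
    field_simp
  rw [e1, e2] at hm
  exact hm

open Filter Topology in
lemma exists_opt {C : Set Z} (hC : IsComplete C) {x y : Z}
    (hm : ∀ a ∈ C, ∀ b ∈ C, ∃ m ∈ C, Cmp x a b m (1/2) ∧ Cmp y a b m (1/2))
    (hd : ∀ ε > 0, ∃ a ∈ C, dist x a + dist a y < dist x y + ε) :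
    ∃ a ∈ C, dist x a + dist a y = dist x y := by
  have hex : ∀ n : ℕ, ∃ a ∈ C, dist x a + dist a y < dist x y + 1 / ((n : ℝ) + 1) :=
    fun n => hd _ (by positivity)
  choose a haC ha using hex
  have hb : ∀ n, dist x (a n) ∈ Set.Icc 0 (dist x y + 1) := by
    intro n
    refine ⟨dist_nonneg, ?_⟩
    have h1 : 1 / ((n : ℝ) + 1) ≤ 1 := by
      rw [div_le_one (by positivity)]
      have : (0 : ℝ) ≤ n := n.cast_nonneg
      linarith
    have := ha n
    have := dist_nonneg (x := a n) (y := y)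
    linarith
  obtain ⟨r, hr, φ, hφ, hlim⟩ := isCompact_Icc.tendsto_subseq hb
  have hlim1 : Tendsto (fun n => dist x (a (φ n))) atTop (𝓝 r) := hlim
  have hε : Tendsto (fun n => 1 / ((φ n : ℝ) + 1)) atTop (𝓝 0) :=
    (tendsto_one_div_add_atTop_nhds_zero_nat (𝕜 := ℝ)).comp hφ.tendsto_atTop
  have hlim2 : Tendsto (fun n => dist y (a (φ n))) atTop (𝓝 (dist x y - r)) := by
    have l1 : Tendsto (fun n => dist x y - dist x (a (φ n))) atTop (𝓝 (dist x y - r)) :=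
      hlim1.const_sub _
    have l2 : Tendsto (fun n => dist x y - dist x (a (φ n)) + 1 / ((φ n : ℝ) + 1)) atTop
        (𝓝 (dist x y - r)) := by
      simpa using l1.add hε
    refine tendsto_of_tendsto_of_tendsto_of_le_of_le l1 l2 ?_ ?_
    · intro n
      have := dist_triangle x (a (φ n)) y
      rw [dist_comm (a (φ n)) y] at this
      simp only
      linarith
    · intro n
      have := ha (φ n)
      rw [dist_comm _ y] at this
      simp only
      linarith
  have hr0 : 0 ≤ r := hr.1
  have hr1 : 0 ≤ dist x y - r := ge_of_tendsto' hlim2 fun n => dist_nonneg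
  have hcau : CauchySeq (fun n => a (φ n)) := by
    rw [Metric.cauchySeq_iff]
    intro ε hε
    have hpos : 0 < ε ^ 2 / 8 := by positivity
    have e1 : ∀ᶠ n in atTop, dist x (a (φ n)) ^ 2 < r ^ 2 + ε ^ 2 / 8 :=
      (hlim1.pow 2).eventually_lt_const (by linarith)
    have e2 : ∀ᶠ n in atTop, dist y (a (φ n)) ^ 2 < (dist x y - r) ^ 2 + ε ^ 2 / 8 :=
      (hlim2.pow 2).eventually_lt_const (by linarith)
    obtain ⟨N, hN⟩ := eventually_atTop.1 (e1.and e2)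
    refine ⟨N, fun i hi j hj => ?_⟩
    by_contra hcon
    push Not at hcon
    have hsq := pow_le_pow_left₀ hε.le hcon 2
    obtain ⟨m, -, m1, m2⟩ := hm _ (haC (φ i)) _ (haC (φ j))
    unfold Cmp at m1 m2
    have f1 : dist x m < r := by
      apply lt_of_pow_lt_pow_left₀ 2 hr0
      linarith [(hN i hi).1, (hN j hj).1]
    have f2 : dist y m < dist x y - r := by
      apply lt_of_pow_lt_pow_left₀ 2 hr1
      linarith [(hN i hi).2, (hN j hj).2]
    have := dist_triangle x m y
    rw [dist_comm m y] at this
    linarith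
  obtain ⟨b, hbC, hbl⟩ := cauchySeq_tendsto_of_isComplete hC (fun n => haC (φ n)) hcau
  refine ⟨b, hbC, ?_⟩
  have t1 := tendsto_nhds_unique hlim1 (tendsto_const_nhds.dist hbl)
  have t2 := tendsto_nhds_unique hlim2 (tendsto_const_nhds.dist hbl)
  rw [dist_comm b y]
  linarith

structure Glue (S T : Set Z) : Prop where
  cover : ∀ z, z ∈ S ∨ z ∈ T
  s : ∀ x ∈ S, ∀ y ∈ S, ∀ l : ℝ, 0 ≤ l → l ≤ 1 → ∃ p ∈ S, ∀ z ∈ S, Cmp z x y p l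
  t : ∀ x ∈ T, ∀ y ∈ T, ∀ l : ℝ, 0 ≤ l → l ≤ 1 → ∃ p ∈ T, ∀ z ∈ T, Cmp z x y p l
  c : ∀ x ∈ S ∩ T, ∀ y ∈ S ∩ T, ∀ l : ℝ, 0 ≤ l → l ≤ 1 → ∃ p ∈ S ∩ T, ∀ z, Cmp z x y p l
  complete : IsComplete (S ∩ T)
  d : ∀ x ∈ S, ∀ y ∈ T, ∀ ε > 0, ∃ a ∈ S ∩ T, dist x a + dist a y < dist x y + ε

namespace Glue
variable {S T : Set Z}

lemma symm (h : Glue S T) : Glue T S where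
  cover z := (h.cover z).symm
  s := h.t
  t := h.s
  c := by rw [Set.inter_comm]; exact h.c
  complete := by rw [Set.inter_comm]; exact h.complete
  d := by
    intro x hx y hy ε hε
    obtain ⟨a, ha, h1⟩ := h.d y hy x hx ε hε
    refine ⟨a, ⟨ha.2, ha.1⟩, ?_⟩
    rw [dist_comm x a, dist_comm a y, dist_comm x y]
    linarith

lemma opt (h : Glue S T) {x y : Z} (hx : x ∈ S) (hy : y ∈ T) :
    ∃ a ∈ S ∩ T, dist x a + dist a y = dist x y := by
  refine exists_opt h.complete ?_ (h.d x hx y hy)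
  intro a ha b hb
  obtain ⟨m, hm, hmz⟩ := h.c a ha b hb (1/2) (by norm_num) (by norm_num)
  exact ⟨m, hm, hmz x, hmz y⟩

lemma step2 (h : Glue S T) {x y : Z} (hx : x ∈ S) (hy : y ∈ S) {l : ℝ} (hl : 0 ≤ l)
    (hl1 : l ≤ 1) : ∃ p ∈ S, ∀ z, Cmp z x y p l := by
  obtain ⟨p, hp, hpz⟩ := h.s x hx y hy l hl hl1
  refine ⟨p, hp, fun z => ?_⟩
  rcases h.cover z with hz | hz
  · exact hpz z hz
  obtain ⟨a, ha, had⟩ := h.opt hx hz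
  obtain ⟨b, hb, hbd⟩ := h.opt hy hz
  have hda : dist z x = dist z a + dist a x := by
    rw [dist_comm z x, dist_comm z a, dist_comm a x]; linarith
  have hdb : dist z y = dist z b + dist b y := by
    rw [dist_comm z y, dist_comm z b, dist_comm b y]; linarith
  refine alex hl hl1 hdb (hpz b hb.1) (hpz x hx) ?_
  intro t ht ht1
  obtain ⟨q, hq, hqz⟩ := h.s b hb.1 x hx (1 - t) (by linarith) (by linarith)
  refine ⟨q, ?_, ?_⟩
  · have : Cmp z b x q (1 - t) := by
      refine alex (by linarith) (by linarith) hda (hqz a ha.1) (hqz b hb.1) ?_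
      intro s hs hs1
      obtain ⟨m, _, hmz⟩ := h.c b hb a ha s hs hs1
      exact ⟨m, hmz z, hmz q⟩
    simpa using this.swap
  · simpa using (hqz p hp).swap

lemma half (h : Glue S T) {x y a : Z} (hx : x ∈ S) (hy : y ∈ T) (ha : a ∈ S ∩ T) {w l : ℝ}
    (hl : 0 ≤ l) (hlw : l ≤ w) (hw1 : w ≤ 1) (hu : dist x a = w * dist x y)
    (hv : dist y a = (1 - w) * dist x y) : ∃ p, ∀ z, Cmp z x y p l := by
  rcases eq_or_lt_of_le (hl.trans hlw) with rfl | hw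
  · obtain rfl : l = 0 := le_antisymm hlw hl
    refine ⟨x, fun z => ?_⟩
    unfold Cmp
    simp
  obtain ⟨p, hp, hpz⟩ := h.step2 hx ha.1 (l := l / w) (by positivity) ((div_le_one hw).2 hlw)
  refine ⟨p, fun z => ?_⟩
  have hk : Cmp z x y a w := by
    refine kink hw.le hw1 hu hv ?_
    intro s hs hs1
    rcases h.cover z with hz | hz
    · obtain ⟨q, _, hq⟩ := h.step2 ha.1 hz hs hs1
      exact ⟨q, hq x, hq y⟩
    · obtain ⟨q, _, hq⟩ := h.symm.step2 ha.2 hz hs hs1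
      exact ⟨q, hq x, hq y⟩
  have hpz := hpz z
  unfold Cmp at *
  rw [hu] at hpz
  have hμ : 0 ≤ l / w := by positivity
  have := mul_le_mul_of_nonneg_left hk hμ
  have e : (1 - l) * dist z x ^ 2 + l * dist z y ^ 2 - l * (1 - l) * dist x y ^ 2 =
    (1 - l / w) * dist z x ^ 2 + l / w * ((1 - w) * dist z x ^ 2 + w * dist z y ^ 2
      - w * (1 - w) * dist x y ^ 2) - l / w * (1 - l / w) * (w * dist x y) ^ 2 := by
    field_simp
    ring
  rw [e]
  linarith

lemma step3 (h : Glue S T) {x y : Z} (hx : x ∈ S) (hy : y ∈ T) {l : ℝ} (hl : 0 ≤ l)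
    (hl1 : l ≤ 1) : ∃ p, ∀ z, Cmp z x y p l := by
  rcases eq_or_lt_of_le (dist_nonneg (x := x) (y := y)) with hD | hD
  · obtain rfl := dist_eq_zero.1 hD.symm
    refine ⟨x, fun z => ?_⟩
    unfold Cmp
    rw [dist_self]
    linarith
  obtain ⟨a, ha, had⟩ := h.opt hx hy
  have hu : dist x a = dist x a / dist x y * dist x y := by field_simp
  have hv : dist y a = (1 - dist x a / dist x y) * dist x y := by
    rw [dist_comm a y] at had
    field_simp
    linarith
  have hw : 0 ≤ dist x a / dist x y := by positivity
  have hw1 : dist x a / dist x y ≤ 1 := by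
    rw [div_le_one hD]
    linarith [dist_nonneg (x := a) (y := y)]
  generalize dist x a / dist x y = w at *
  rcases le_total l w with hlw | hlw
  · exact h.half hx hy ha hl hlw hw1 hu hv
  · obtain ⟨p, hp⟩ := h.symm.half (a := a) hy hx ⟨ha.2, ha.1⟩ (w := 1 - w) (l := 1 - l)
      (by linarith) (by linarith) (by linarith) (by rw [hv, dist_comm x y])
      (by rw [hu, dist_comm x y]; ring)
    refine ⟨p, fun z => ?_⟩
    simpa using (hp z).swap

lemma all (h : Glue S T) (x y : Z) {l : ℝ} (hl : 0 ≤ l)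
    (hl1 : l ≤ 1) : ∃ p, ∀ z, Cmp z x y p l := by
  rcases h.cover x with hx | hx <;> rcases h.cover y with hy | hy
  · obtain ⟨p, _, hp⟩ := h.step2 hx hy hl hl1
    exact ⟨p, hp⟩
  · exact h.step3 hx hy hl hl1
  · exact h.symm.step3 hx hy hl hl1
  · obtain ⟨p, _, hp⟩ := h.symm.step2 hx hy hl hl1
    exact ⟨p, hp⟩

end Glue

lemma cat0_of_all (h : ∀ (x y : Z) (l : ℝ), 0 ≤ l → l ≤ 1 → ∃ p, ∀ z, Cmp z x y p l) :
    CAT0 Z := by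
  constructor
  · intro x y
    rcases eq_or_lt_of_le (dist_nonneg (x := x) (y := y)) with hD | hD
    · obtain rfl := dist_eq_zero.1 hD.symm
      refine ⟨fun _ => x, ?_, rfl, rfl⟩
      intro s hs t ht
      rw [dist_self] at hs ht
      have h1 : s = 0 := le_antisymm hs.2 hs.1
      have h2 : t = 0 := le_antisymm ht.2 ht.1
      simp [h1, h2]
    have h' : ∀ l : ℝ, ∃ p, (0 ≤ l ∧ l ≤ 1 → ∀ z, Cmp z x y p l) := by
      intro l
      by_cases hl : 0 ≤ l ∧ l ≤ 1
      · obtain ⟨p, hp⟩ := h x y l hl.1 hl.2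
        exact ⟨p, fun _ => hp⟩
      · exact ⟨x, fun h => absurd h hl⟩
    choose p hp using h'
    have hx : ∀ l, 0 ≤ l → l ≤ 1 → dist x (p l) ≤ l * dist x y :=
      fun l h0 h1 => (hp l ⟨h0, h1⟩ x).left_le h0
    have hy : ∀ l, 0 ≤ l → l ≤ 1 → dist y (p l) ≤ (1 - l) * dist x y :=
      fun l h0 h1 => (hp l ⟨h0, h1⟩ y).right_le h1
    have hb : ∀ l m, 0 ≤ l → l ≤ 1 → 0 ≤ m → m ≤ 1 →
        dist (p l) (p m) ≤ |l - m| * dist x y := fun l m h0 h1 h2 h3 =>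
      Cmp.bound h2 h3 (hx l h0 h1) (hy l h0 h1) (hp m ⟨h2, h3⟩ (p l))
    have hle : ∀ l m, 0 ≤ l → l ≤ m → m ≤ 1 → dist (p l) (p m) = (m - l) * dist x y := by
      intro l m h0 h1 h2
      have e1 := hb l m h0 (by linarith) (by linarith) h2
      rw [abs_of_nonpos (by linarith)] at e1
      have e2 := hx l h0 (by linarith)
      have e3 := hy m (by linarith) h2
      have e4 := dist_triangle4 x (p l) (p m) y
      rw [dist_comm (p m) y] at e4
      apply le_antisymm <;> linarith
    refine ⟨fun t => p (t / dist x y), ?_, ?_, ?_⟩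
    · intro s hs t ht
      have hs0 : 0 ≤ s / dist x y := div_nonneg hs.1 hD.le
      have ht0 : 0 ≤ t / dist x y := div_nonneg ht.1 hD.le
      have hs1 : s / dist x y ≤ 1 := (div_le_one hD).2 hs.2
      have ht1 : t / dist x y ≤ 1 := (div_le_one hD).2 ht.2
      rcases le_total s t with hst | hst
      · rw [abs_of_nonpos (by linarith)]
        simp only
        rw [hle _ _ hs0 (by gcongr) ht1]
        field_simp
        ring
      · rw [abs_of_nonneg (by linarith), dist_comm]
        simp only
        rw [hle _ _ ht0 (by gcongr) hs1]
        field_simp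
    · have := hx 0 le_rfl zero_le_one
      rw [zero_mul] at this
      simp only [zero_div]
      exact (dist_le_zero.1 this).symm
    · have := hy 1 zero_le_one le_rfl
      rw [sub_self, zero_mul] at this
      simp only [div_self hD.ne']
      exact (dist_le_zero.1 this).symm
  · intro x y z γ hγ h0 h1 l hl
    obtain ⟨p, hp⟩ := h x y l hl.1 hl.2
    have hD := dist_nonneg (x := x) (y := y)
    have hm : l * dist x y ∈ Set.Icc 0 (dist x y) :=
      ⟨mul_nonneg hl.1 hD, by nlinarith [hl.2]⟩
    have e1 := hγ 0 ⟨le_rfl, hD⟩ _ hm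
    have e2 := hγ (dist x y) ⟨hD, le_rfl⟩ _ hm
    rw [h0, zero_sub, abs_neg, abs_of_nonneg hm.1] at e1
    rw [h1, abs_of_nonneg (by linarith [hm.2])] at e2
    have : γ (l * dist x y) = p :=
      Cmp.uniq hl.1 hl.2 e1.le (by linarith) (hp _)
    rw [this]
    exact hp z

lemma range_pt {X : Type*} [MetricSpace X] (h : CAT0 X) {j : X → Z} (hj : Isometry j)
    {F : Set X} (hF : GeodConvex F) {x y : X} (hx : x ∈ F) (hy : y ∈ F)
    {l : ℝ} (hl : 0 ≤ l) (hl1 : l ≤ 1) :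
    ∃ p ∈ F, ∀ z ∈ Set.range j, Cmp z (j x) (j y) (j p) l := by
  obtain ⟨γ, hγ, h0, h1⟩ := h.1 x y
  have hD := dist_nonneg (x := x) (y := y)
  refine ⟨γ (l * dist x y), hF x hx y hy γ hγ h0 h1 _
    ⟨mul_nonneg hl hD, by nlinarith⟩, ?_⟩
  rintro _ ⟨z, rfl⟩
  unfold Cmp
  simp only [hj.dist_eq]
  exact h.2 x y z γ hγ h0 h1 l ⟨hl, hl1⟩

lemma range_s {X : Type*} [MetricSpace X] (h : CAT0 X) {j : X → Z} (hj : Isometry j) :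
    ∀ x ∈ Set.range j, ∀ y ∈ Set.range j, ∀ l : ℝ, 0 ≤ l → l ≤ 1 →
      ∃ p ∈ Set.range j, ∀ z ∈ Set.range j, Cmp z x y p l := by
  rintro _ ⟨x, rfl⟩ _ ⟨y, rfl⟩ l hl hl1
  obtain ⟨p, -, hp⟩ := range_pt h hj (F := Set.univ) (fun _ _ _ _ _ _ _ _ _ _ => trivial)
    (Set.mem_univ x) (Set.mem_univ y) hl hl1
  exact ⟨j p, ⟨p, rfl⟩, hp⟩

end aux

/-- Reshetnyak's gluing theorem: if `Z` is the amalgamation of the CAT(0) spaces `X₁`, `X₂`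
along a complete metric space `A`, glued isometrically onto convex subsets via `i₁, i₂`, with
the amalgamated distance `d(x,y) = inf_a (d(x,i₁ a) + d(i₂ a, y))` across the two pieces, then
`Z` is a CAT(0) space. -/
theorem stmt_19 {X₁ X₂ A Z : Type*} [MetricSpace X₁] [MetricSpace X₂]
    [MetricSpace A] [CompleteSpace A] [Nonempty A] [MetricSpace Z]
    (h₁ : CAT0 X₁) (h₂ : CAT0 X₂)
    (i₁ : A → X₁) (i₂ : A → X₂) (hi₁ : Isometry i₁) (hi₂ : Isometry i₂)
    (hc₁ : GeodConvex (Set.range i₁)) (hc₂ : GeodConvex (Set.range i₂))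
    (j₁ : X₁ → Z) (j₂ : X₂ → Z) (hj₁ : Isometry j₁) (hj₂ : Isometry j₂)
    (hglue : ∀ a : A, j₁ (i₁ a) = j₂ (i₂ a))
    (hcover : Set.range j₁ ∪ Set.range j₂ = Set.univ)
    (hinter : Set.range j₁ ∩ Set.range j₂ = Set.range (fun a : A => j₁ (i₁ a)))
    (hdist : ∀ (x : X₁) (y : X₂),
      dist (j₁ x) (j₂ y) = ⨅ a : A, dist x (i₁ a) + dist (i₂ a) y) :
    CAT0 Z := by
  refine cat0_of_all fun x y l hl hl1 =>
    Glue.all (S := Set.range j₁) (T := Set.range j₂) ?_ x y hl hl1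
  refine ⟨?_, range_s h₁ hj₁, range_s h₂ hj₂, ?_, ?_, ?_⟩
  · intro z
    have : z ∈ Set.range j₁ ∪ Set.range j₂ := by rw [hcover]; trivial
    exact this
  · intro x hx y hy l hl hl1
    have hx2 := hx.2
    have hy2 := hy.2
    have hx1 := hx.1
    have hy1 := hy.1
    rw [hinter] at hx hy
    obtain ⟨a, rfl⟩ := hx
    obtain ⟨b, rfl⟩ := hy
    obtain ⟨_, ⟨c, rfl⟩, hp⟩ := range_pt h₁ hj₁ hc₁ (Set.mem_range_self a)
      (Set.mem_range_self b) hl hl1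
    obtain ⟨q, hq, hqz⟩ := range_s h₂ hj₂ _ hx2 _ hy2 l hl hl1
    have hmem : j₁ (i₁ c) ∈ Set.range j₁ ∩ Set.range j₂ := by
      rw [hinter]; exact ⟨c, rfl⟩
    have heq : j₁ (i₁ c) = q :=
      Cmp.uniq hl hl1 ((hp _ hx1).left_le hl) ((hp _ hy1).right_le hl1) (hqz _ hmem.2)
    refine ⟨j₁ (i₁ c), hmem, fun z => ?_⟩
    have : z ∈ Set.range j₁ ∪ Set.range j₂ := by rw [hcover]; trivial
    rcases this with hz | hz
    · exact hp z hz
    · rw [heq]; exact hqz z hz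
  · rw [hinter]
    exact (hj₁.comp hi₁).isUniformInducing.isComplete_range
  · rintro _ ⟨x, rfl⟩ _ ⟨y, rfl⟩ ε hε
    have hlt : (⨅ a : A, dist x (i₁ a) + dist (i₂ a) y) < dist (j₁ x) (j₂ y) + ε := by
      rw [← hdist]; linarith
    obtain ⟨a, ha⟩ := exists_lt_of_ciInf_lt hlt
    refine ⟨j₁ (i₁ a), by rw [hinter]; exact ⟨a, rfl⟩, ?_⟩
    have e : dist (j₁ (i₁ a)) (j₂ y) = dist (i₂ a) y := by rw [hglue, hj₂.dist_eq]
    rw [e, hj₁.dist_eq]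
    exact ha
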